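/- Let Γ be a positive-valued recursive game, and fix M > 0, n₀ ≥ 1 and a mapping n(·) : X⁰ → {1,…,n₀} such that v_{n(x)}(x) ≥ M for every x ∈ X⁰. Then player 1 uniformly guarantees v_{n(·)}(·) with uniformly terminating strategies that depend only on the sequence of states: for every ε > 0 there exist σ* ∈ Σ̂ and N₀ ≥ 1 such that for every initial state x₁ ∈ X⁰ and every τ ∈ 𝒯: (i) P_{x₁,σ*,τ}(ρ ≤ N₀) ≥ 1 − ε, and (ii) γ_n(x₁,σ*,τ) ≥ v_{n(x₁)}(x₁) − ε for all n ≥ N₀. -/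

import Mathlib

open scoped Classical
open Filter

noncomputable section

/-- A two-player zero-sum stochastic game: a state space `X`, action sets `A`, `B`
with a nonempty finite feasible subset at every state, a payoff function with values
in `[-1,1]`, and a finitely supported transition probability function. -/
structure StocGame where
  X : Type
  A : Type
  B : Type
  actA : X → Finset A
  actB : X → Finset B
  actA_nonempty : ∀ x, (actA x).Nonempty
  actB_nonempty : ∀ x, (actB x).Nonempty
  g : X → A → B → ℝ
  g_bdd : ∀ x a b, |g x a b| ≤ 1
  q : X → A → B → X → ℝ
  q_nonneg : ∀ x a b y, 0 ≤ q x a b y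
  q_finsupp : ∀ x a b, (Function.support (q x a b)).Finite
  q_sum : ∀ x a b, (∑' y, q x a b y) = 1

namespace StocGame

variable (G : StocGame)

/-- A behavior strategy of player 1: to every past history (a chronological list of
(state, action of player 1, action of player 2) triples) and every current state, it
assigns a mixed action supported on the feasible action set. -/
structure Strategy1 where
  play : List (G.X × G.A × G.B) → G.X → G.A → ℝ
  nonneg : ∀ h x a, 0 ≤ play h x a
  supp : ∀ h x a, a ∉ G.actA x → play h x a = 0
  sum_one : ∀ h x, ∑ a ∈ G.actA x, play h x a = 1

/-- A behavior strategy of player 2. -/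
structure Strategy2 where
  play : List (G.X × G.A × G.B) → G.X → G.B → ℝ
  nonneg : ∀ h x b, 0 ≤ play h x b
  supp : ∀ h x b, b ∉ G.actB x → play h x b = 0
  sum_one : ∀ h x, ∑ b ∈ G.actB x, play h x b = 1

variable {G}

/-- The chronological sequence of states visited along a finite history
(past history together with the current state). -/
def stateSeq (hx : List (G.X × G.A × G.B) × G.X) : List G.X :=
  hx.1.map Prod.fst ++ [hx.2]

/-- A strategy of player 1 which depends on the history only through the sequence of
visited states (and not on past actions). -/
def Strategy1.stateDep (σ : Strategy1 G) : Prop :=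
  ∀ h h' x, h.map Prod.fst = h'.map Prod.fst → σ.play h x = σ.play h' x

/-- A strategy of player 2 which depends on the history only through the sequence of
visited states (and not on past actions). -/
def Strategy2.stateDep (τ : Strategy2 G) : Prop :=
  ∀ h h' x, h.map Prod.fst = h'.map Prod.fst → τ.play h x = τ.play h' x

/-- A pure strategy of player 1. -/
def Strategy1.pure (σ : Strategy1 G) : Prop :=
  ∀ h x, ∃ a ∈ G.actA x, σ.play h x a = 1

/-- A pure strategy of player 2. -/
def Strategy2.pure (τ : Strategy2 G) : Prop :=
  ∀ h x, ∃ b ∈ G.actB x, τ.play h x b = 1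

variable (G)

/-- Auxiliary function: the probability of a finite history, the past history being
given in reverse chronological order. -/
def histProbAux (x₁ : G.X) (σ : Strategy1 G) (τ : Strategy2 G) :
    List (G.X × G.A × G.B) → G.X → ℝ
  | [], x => if x = x₁ then 1 else 0
  | (y, a, b) :: rest, x =>
      histProbAux x₁ σ τ rest y * σ.play rest.reverse y a * τ.play rest.reverse y b *
        G.q y a b x

/-- Probability, in the game starting at `x₁` played with `(σ, τ)`, that the play starts
with the (chronological) past history `h` followed by the current state `x`. -/
def histProb (x₁ : G.X) (σ : Strategy1 G) (τ : Strategy2 G)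
    (h : List (G.X × G.A × G.B)) (x : G.X) : ℝ :=
  G.histProbAux x₁ σ τ h.reverse x

/-- Expected payoff of stage `t` in the game starting at `x₁` played with `(σ, τ)`. -/
def stagePayoff (x₁ : G.X) (σ : Strategy1 G) (τ : Strategy2 G) (t : ℕ) : ℝ :=
  ∑' hx : List (G.X × G.A × G.B) × G.X,
    if hx.1.length + 1 = t then
      G.histProb x₁ σ τ hx.1 hx.2 *
        ∑ a ∈ G.actA hx.2, ∑ b ∈ G.actB hx.2,
          σ.play hx.1 hx.2 a * τ.play hx.1 hx.2 b * G.g hx.2 a b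
    else 0

/-- Expected average payoff `γ_n(x₁, σ, τ)` over the `n` first stages. -/
def avgPayoff (x₁ : G.X) (σ : Strategy1 G) (τ : Strategy2 G) (n : ℕ) : ℝ :=
  (n : ℝ)⁻¹ * ∑ t ∈ Finset.Icc 1 n, G.stagePayoff x₁ σ τ t

/-- Expected `λ`-discounted payoff `γ_λ(x₁, σ, τ)`. -/
def discPayoff (x₁ : G.X) (σ : Strategy1 G) (τ : Strategy2 G) (lam : ℝ) : ℝ :=
  ∑' t : ℕ, lam * (1 - lam) ^ t * G.stagePayoff x₁ σ τ (t + 1)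

/-- The value `v_n(x₁)` of the `n`-stage game (by the minmax theorem, the game has a
value, which is then equal to this maxmin). -/
def nValue (n : ℕ) (x₁ : G.X) : ℝ :=
  ⨆ σ : Strategy1 G, ⨅ τ : Strategy2 G, G.avgPayoff x₁ σ τ n

/-- The value `v_λ(x₁)` of the `λ`-discounted game. -/
def lamValue (lam : ℝ) (x₁ : G.X) : ℝ :=
  ⨆ σ : Strategy1 G, ⨅ τ : Strategy2 G, G.discPayoff x₁ σ τ lam

/-- The pointwise limit superior `v(x) = limsup_n v_n(x)` of the `n`-stage values. -/
def limsupV (x : G.X) : ℝ := Filter.limsup (fun n => G.nValue n x) Filter.atTop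

/-- The family `{v_n, n ≥ 1}` is totally bounded for the uniform norm: for every
`ε > 0` there is a finite subfamily within uniform distance `ε` of every member. -/
def TotallyBoundedValues : Prop :=
  ∀ ε > (0 : ℝ), ∃ S : Finset ℕ, (∀ m ∈ S, 1 ≤ m) ∧
    ∀ n, 1 ≤ n → ∃ m ∈ S, ∀ x, |G.nValue n x - G.nValue m x| ≤ ε

/-- Probability that the sequence of the first states of the play is `s`. -/
def statesProb (x₁ : G.X) (σ : Strategy1 G) (τ : Strategy2 G) (s : List G.X) : ℝ :=
  ∑' hx : List (G.X × G.A × G.B) × G.X,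
    if stateSeq hx = s then G.histProb x₁ σ τ hx.1 hx.2 else 0

end StocGame

/-- A two-player zero-sum recursive game: a stochastic game whose state space is
partitioned into active states (where the payoff is `0`) and absorbing states (which
are trapping, with a payoff depending only on the state). -/
structure RecGame extends StocGame where
  absorbing : X → Prop
  g_active : ∀ x a b, ¬ absorbing x → g x a b = 0
  absorbing_q : ∀ x a b, absorbing x → q x a b x = 1
  absorbing_g : ∀ x a b a' b', absorbing x → g x a b = g x a' b'

namespace RecGame

variable (G : RecGame)

/-- The stage payoff as a function of the state only: `0` on active states, and the
absorbing payoff on absorbing states. -/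
def stateg (x : G.X) : ℝ :=
  G.g x (G.actA_nonempty x).choose (G.actB_nonempty x).choose

/-- Probability that the play is absorbed within the first `N` stages; since absorbing
states are trapping this is the probability that the state of stage `N` is absorbing,
i.e. `P(ρ ≤ N)` where `ρ` is the absorption time. -/
def absorbedProb (x₁ : G.X) (σ : G.toStocGame.Strategy1) (τ : G.toStocGame.Strategy2)
    (N : ℕ) : ℝ :=
  ∑' hx : List (G.X × G.A × G.B) × G.X,
    if hx.1.length + 1 = N ∧ G.absorbing hx.2 then
      G.toStocGame.histProb x₁ σ τ hx.1 hx.2 else 0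

/-- A uniformly terminating strategy of player 1. -/
def UniformlyTerminating1 (σ : G.toStocGame.Strategy1) : Prop :=
  ∀ ε > (0 : ℝ), ∃ N : ℕ, 1 ≤ N ∧ ∀ x₁, ¬ G.absorbing x₁ →
    ∀ τ, G.absorbedProb x₁ σ τ N ≥ 1 - ε

end RecGame

namespace StocGame

variable (G : StocGame)

/-- Expectation of `f` at the state that follows `x` when `a` and `b` are played. -/
def nextExp (f : G.X → ℝ) (x : G.X) (a : G.A) (b : G.B) : ℝ :=
  ∑' y, G.q x a b y * f y

/-- `p` is a mixed action of player 1 at `x`. -/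
def IsMixed1 (x : G.X) (p : G.A → ℝ) : Prop :=
  (∀ a, 0 ≤ p a) ∧ (∀ a, a ∉ G.actA x → p a = 0) ∧ ∑ a ∈ G.actA x, p a = 1

lemma summable_q_mul (f : G.X → ℝ) (x : G.X) (a : G.A) (b : G.B) :
    Summable fun y => G.q x a b y * f y :=
  summable_of_hasFiniteSupport ((G.q_finsupp x a b).subset (Function.support_mul_subset_left _ _))

lemma nextExp_mono {f f' : G.X → ℝ} (hf : ∀ y, f y ≤ f' y) (x : G.X) (a : G.A) (b : G.B) :
    G.nextExp f x a b ≤ G.nextExp f' x a b :=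
  (G.summable_q_mul f x a b).tsum_le_tsum
    (fun y => mul_le_mul_of_nonneg_left (hf y) (G.q_nonneg x a b y)) (G.summable_q_mul f' x a b)

lemma nextExp_const (c : ℝ) (x : G.X) (a : G.A) (b : G.B) :
    G.nextExp (fun _ => c) x a b = c := by
  rw [nextExp, tsum_mul_right, G.q_sum, one_mul]

lemma nextExp_const_mul (c : ℝ) (f : G.X → ℝ) (x : G.X) (a : G.A) (b : G.B) :
    G.nextExp (fun y => c * f y) x a b = c * G.nextExp f x a b := by
  simp only [nextExp, ← tsum_mul_left]
  exact tsum_congr fun y => by ring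

lemma nextExp_add_const (f : G.X → ℝ) (c : ℝ) (x : G.X) (a : G.A) (b : G.B) :
    G.nextExp (fun y => f y + c) x a b = G.nextExp f x a b + c := by
  simp only [nextExp, mul_add]
  rw [(G.summable_q_mul f x a b).tsum_add (G.summable_q_mul (fun _ => c) x a b)]
  congr 1
  exact G.nextExp_const c x a b

/-- The one-shot game at `x` with continuation payoff `f` has an optimal mixed action. -/
lemma exists_optimal (f : G.X → ℝ) (x : G.X) :
    ∃ (c : ℝ) (p : G.A → ℝ), G.IsMixed1 x p ∧
      (∀ b ∈ G.actB x, c ≤ ∑ a ∈ G.actA x, p a * G.nextExp f x a b) ∧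
      ∀ p', G.IsMixed1 x p' →
        ∃ b ∈ G.actB x, ∑ a ∈ G.actA x, p' a * G.nextExp f x a b ≤ c := by
  let φ : (G.actA x → ℝ) → ℝ := fun p =>
    (G.actB x).inf' (G.actB_nonempty x) fun b => ∑ a : G.actA x, p a * G.nextExp f x a b
  have hφ : Continuous φ := by
    refine Continuous.finset_inf'_apply _ fun b _ => ?_
    fun_prop
  have : Nonempty (G.actA x) := (G.actA_nonempty x).to_subtype
  obtain ⟨p, hp, hmax⟩ := (isCompact_stdSimplex ℝ (G.actA x)).exists_isMaxOn
    ⟨_, single_mem_stdSimplex ℝ (Classical.arbitrary (G.actA x))⟩ hφ.continuousOn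
  refine ⟨φ p, fun a => if h : a ∈ G.actA x then p ⟨a, h⟩ else 0, ⟨?_, ?_, ?_⟩, ?_, ?_⟩
  · intro a
    dsimp only
    split_ifs with h
    · exact hp.1 _
    · exact le_rfl
  · intro a h
    simp [h]
  · rw [← Finset.sum_coe_sort]
    simpa using hp.2
  · intro b hb
    rw [← Finset.sum_coe_sort]
    have h : φ p ≤ ∑ a : G.actA x, p a * G.nextExp f x a b :=
      Finset.inf'_le (fun b => ∑ a : G.actA x, p a * G.nextExp f x a b) hb
    simpa using h
  · intro p' hp'
    obtain ⟨b, hb, hmin⟩ := Finset.exists_mem_eq_inf' (G.actB_nonempty x)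
      fun b => ∑ a : G.actA x, p' a * G.nextExp f x a b
    refine ⟨b, hb, ?_⟩
    rw [← Finset.sum_coe_sort, ← hmin]
    refine hmax (a := fun a : G.actA x => p' a) ⟨fun a => hp'.1 a, ?_⟩
    rw [Finset.sum_coe_sort (G.actA x) p']
    exact hp'.2.2

/-- The Shapley operator: value of the one-shot game with continuation payoff `f`. -/
def shapley (f : G.X → ℝ) (x : G.X) : ℝ := (G.exists_optimal f x).choose

/-- An optimal mixed action of player 1 in the one-shot game with continuation payoff `f`. -/
def optAct (f : G.X → ℝ) (x : G.X) : G.A → ℝ := (G.exists_optimal f x).choose_spec.choose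

lemma optAct_isMixed1 (f : G.X → ℝ) (x : G.X) : G.IsMixed1 x (G.optAct f x) :=
  (G.exists_optimal f x).choose_spec.choose_spec.1

lemma shapley_le_optAct (f : G.X → ℝ) (x : G.X) {b : G.B} (hb : b ∈ G.actB x) :
    G.shapley f x ≤ ∑ a ∈ G.actA x, G.optAct f x a * G.nextExp f x a b :=
  (G.exists_optimal f x).choose_spec.choose_spec.2.1 b hb

lemma exists_le_shapley (f : G.X → ℝ) (x : G.X) {p : G.A → ℝ} (hp : G.IsMixed1 x p) :
    ∃ b ∈ G.actB x, ∑ a ∈ G.actA x, p a * G.nextExp f x a b ≤ G.shapley f x :=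
  (G.exists_optimal f x).choose_spec.choose_spec.2.2 p hp

lemma shapley_add_le {w f : G.X → ℝ} {k d : ℝ} (hk : 0 ≤ k) (h : ∀ y, w y + d ≤ k * f y)
    (x : G.X) : G.shapley w x + d ≤ k * G.shapley f x := by
  have hp := G.optAct_isMixed1 w x
  obtain ⟨b, hb, hbf⟩ := G.exists_le_shapley f x hp
  have h1 := G.shapley_le_optAct w x hb
  have h2 : ∑ a ∈ G.actA x, G.optAct w x a * (G.nextExp w x a b + d) ≤
      ∑ a ∈ G.actA x, G.optAct w x a * (k * G.nextExp f x a b) := by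
    refine Finset.sum_le_sum fun a _ => mul_le_mul_of_nonneg_left ?_ (hp.1 a)
    rw [← nextExp_add_const, ← nextExp_const_mul]
    exact G.nextExp_mono h x a b
  have h3 : ∑ a ∈ G.actA x, G.optAct w x a * (G.nextExp w x a b + d) =
      ∑ a ∈ G.actA x, G.optAct w x a * G.nextExp w x a b + d := by
    simp only [mul_add, Finset.sum_add_distrib, ← Finset.sum_mul, hp.2.2, one_mul]
  have h4 : ∑ a ∈ G.actA x, G.optAct w x a * (k * G.nextExp f x a b) =
      k * ∑ a ∈ G.actA x, G.optAct w x a * G.nextExp f x a b := by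
    rw [Finset.mul_sum]
    exact Finset.sum_congr rfl fun a _ => by ring
  have h5 := mul_le_mul_of_nonneg_left hbf hk
  linarith

lemma le_shapley_of_le {f : G.X → ℝ} {c : ℝ} (h : ∀ y, c ≤ f y) (x : G.X) :
    c ≤ G.shapley f x := by
  have hp := G.optAct_isMixed1 f x
  obtain ⟨b, -, hbf⟩ := G.exists_le_shapley f x hp
  refine le_trans ?_ hbf
  calc c = ∑ a ∈ G.actA x, G.optAct f x a * c := by rw [← Finset.sum_mul, hp.2.2, one_mul]
    _ ≤ _ := Finset.sum_le_sum fun a _ => mul_le_mul_of_nonneg_left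
      (by simpa only [nextExp_const] using G.nextExp_mono h x a b) (hp.1 a)

variable {G}

/-- Expectation of `φ` at the state reached after `n` transitions, together with its history. -/
def histExp (x₁ : G.X) (σ : Strategy1 G) (τ : Strategy2 G) (n : ℕ)
    (φ : List (G.X × G.A × G.B) → G.X → ℝ) : ℝ :=
  ∑' hx : List (G.X × G.A × G.B) × G.X,
    if hx.1.length = n then G.histProb x₁ σ τ hx.1 hx.2 * φ hx.1 hx.2 else 0

/-- Conditional expectation of `φ` one stage ahead. -/
def condStep (σ : Strategy1 G) (τ : Strategy2 G) (φ : List (G.X × G.A × G.B) → G.X → ℝ)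
    (h : List (G.X × G.A × G.B)) (x : G.X) : ℝ :=
  ∑ a ∈ G.actA x, ∑ b ∈ G.actB x,
    σ.play h x a * τ.play h x b * G.nextExp (φ (h ++ [(x, a, b)])) x a b

lemma histProb_nil (x₁ : G.X) (σ : Strategy1 G) (τ : Strategy2 G) (x : G.X) :
    G.histProb x₁ σ τ [] x = if x = x₁ then 1 else 0 := by
  simp [histProb, histProbAux]

lemma histProb_append (x₁ : G.X) (σ : Strategy1 G) (τ : Strategy2 G)
    (h : List (G.X × G.A × G.B)) (x : G.X) (a : G.A) (b : G.B) (y : G.X) :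
    G.histProb x₁ σ τ (h ++ [(x, a, b)]) y =
      G.histProb x₁ σ τ h x * σ.play h x a * τ.play h x b * G.q x a b y := by
  simp [histProb, histProbAux]

lemma histProb_nonneg (x₁ : G.X) (σ : Strategy1 G) (τ : Strategy2 G)
    (h : List (G.X × G.A × G.B)) (x : G.X) : 0 ≤ G.histProb x₁ σ τ h x := by
  induction h using List.reverseRecOn generalizing x with
  | nil => rw [histProb_nil]; split_ifs <;> norm_num
  | append_singleton h e ih =>
    obtain ⟨y, a, b⟩ := e
    rw [histProb_append]
    exact mul_nonneg (mul_nonneg (mul_nonneg (ih y) (σ.nonneg _ _ _)) (τ.nonneg _ _ _))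
      (G.q_nonneg _ _ _ _)

/-- The map appending the current state and the actions to the history. -/
def extendHist (e : (List (G.X × G.A × G.B) × G.X) × (G.A × G.B) × G.X) :
    List (G.X × G.A × G.B) × G.X :=
  (e.1.1 ++ [(e.1.2, e.2.1.1, e.2.1.2)], e.2.2)

lemma extendHist_injective : Function.Injective (extendHist (G := G)) := by
  rintro ⟨⟨h, x⟩, ⟨a, b⟩, y⟩ ⟨⟨h', x'⟩, ⟨a', b'⟩, y'⟩ heq
  simp only [extendHist, Prod.mk.injEq] at heq
  obtain ⟨h1, rfl⟩ := heq
  obtain ⟨rfl, h2⟩ := List.append_inj' h1 rfl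
  simp_all

lemma exists_extendHist {n : ℕ} {hx : List (G.X × G.A × G.B) × G.X} (h : hx.1.length = n + 1) :
    ∃ e, extendHist e = hx := by
  obtain ⟨l, y⟩ := hx
  induction l using List.reverseRecOn with
  | nil => simp at h
  | append_singleton l e _ => exact ⟨((l, e.1), (e.2.1, e.2.2), y), rfl⟩

lemma finite_histProb_support (x₁ : G.X) (σ : Strategy1 G) (τ : Strategy2 G) (n : ℕ) :
    {hx : List (G.X × G.A × G.B) × G.X |
      hx.1.length = n ∧ G.histProb x₁ σ τ hx.1 hx.2 ≠ 0}.Finite := by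
  induction n with
  | zero =>
    refine (Set.finite_singleton (([], x₁) : List (G.X × G.A × G.B) × G.X)).subset ?_
    rintro ⟨h, x⟩ ⟨hl, hp⟩
    obtain rfl := List.length_eq_zero_iff.1 hl
    rw [histProb_nil] at hp
    by_cases hx : x = x₁
    · simp [hx]
    · simp [hx] at hp
  | succ n ih =>
    refine (ih.biUnion fun hx _ => (((G.actA hx.2).finite_toSet.prod
      (G.actB hx.2).finite_toSet).biUnion fun ab _ =>
        ((G.q_finsupp hx.2 ab.1 ab.2).image fun y => extendHist (hx, ab, y)))).subset ?_
    rintro hx ⟨hl, hp⟩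
    obtain ⟨⟨⟨h, x⟩, ⟨a, b⟩, y⟩, rfl⟩ := exists_extendHist hl
    simp only [extendHist, histProb_append, ne_eq, mul_eq_zero, not_or] at hp
    simp only [extendHist, List.length_append, List.length_singleton,
      Nat.add_right_cancel_iff] at hl
    simp only [Set.mem_iUnion]
    refine ⟨(h, x), ⟨hl, hp.1.1.1⟩, (a, b), ⟨?_, ?_⟩, y, hp.2, rfl⟩
    · by_contra hc
      exact hp.1.1.2 (σ.supp _ _ _ hc)
    · by_contra hc
      exact hp.1.2 (τ.supp _ _ _ hc)

lemma finite_support_histExp (x₁ : G.X) (σ : Strategy1 G) (τ : Strategy2 G) (n : ℕ)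
    (φ : List (G.X × G.A × G.B) → G.X → ℝ) :
    (Function.support fun hx : List (G.X × G.A × G.B) × G.X =>
      if hx.1.length = n then G.histProb x₁ σ τ hx.1 hx.2 * φ hx.1 hx.2 else 0).Finite := by
  refine (finite_histProb_support x₁ σ τ n).subset fun hx h => ?_
  rw [Function.mem_support] at h
  by_cases hl : hx.1.length = n
  · rw [if_pos hl] at h
    exact ⟨hl, left_ne_zero_of_mul h⟩
  · simp [hl] at h

lemma summable_histExp (x₁ : G.X) (σ : Strategy1 G) (τ : Strategy2 G) (n : ℕ)
    (φ : List (G.X × G.A × G.B) → G.X → ℝ) :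
    Summable fun hx : List (G.X × G.A × G.B) × G.X =>
      if hx.1.length = n then G.histProb x₁ σ τ hx.1 hx.2 * φ hx.1 hx.2 else 0 :=
  summable_of_hasFiniteSupport (finite_support_histExp x₁ σ τ n φ)

lemma histExp_zero (x₁ : G.X) (σ : Strategy1 G) (τ : Strategy2 G)
    (φ : List (G.X × G.A × G.B) → G.X → ℝ) : histExp x₁ σ τ 0 φ = φ [] x₁ := by
  rw [histExp, tsum_eq_single ([], x₁)]
  · simp [histProb_nil]
  · rintro ⟨h, x⟩ hne
    by_cases hl : h = []
    · subst hl
      have : x ≠ x₁ := fun hx => hne (by rw [hx])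
      simp [histProb_nil, this]
    · simp [hl]

lemma histExp_succ (x₁ : G.X) (σ : Strategy1 G) (τ : Strategy2 G) (n : ℕ)
    (φ : List (G.X × G.A × G.B) → G.X → ℝ) :
    histExp x₁ σ τ (n + 1) φ = histExp x₁ σ τ n (condStep σ τ φ) := by
  have hsupp := finite_support_histExp x₁ σ τ (n + 1) φ
  rw [histExp, ← (extendHist_injective (G := G)).tsum_eq]
  swap
  · intro hx h
    rw [Function.mem_support] at h
    by_cases hl : hx.1.length = n + 1
    · exact exists_extendHist hl
    · simp [hl] at h
  have hsum := (summable_of_hasFiniteSupport hsupp).comp_injective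
    (extendHist_injective (G := G))
  rw [histExp]
  refine (hsum.tsum_prod).trans (tsum_congr ?_)
  rintro ⟨h, x⟩
  have hsum' := hsum.prod_factor (h, x)
  refine (hsum'.tsum_prod).trans ?_
  by_cases hl : h.length = n
  · have key : ∀ ab : G.A × G.B, (∑' y, if (extendHist ((h, x), ab, y)).1.length = n + 1 then
        G.histProb x₁ σ τ (extendHist ((h, x), ab, y)).1 (extendHist ((h, x), ab, y)).2 *
          φ (extendHist ((h, x), ab, y)).1 (extendHist ((h, x), ab, y)).2 else 0) =
        G.histProb x₁ σ τ h x * (σ.play h x ab.1 * τ.play h x ab.2 *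
          G.nextExp (φ (h ++ [(x, ab.1, ab.2)])) x ab.1 ab.2) := by
      rintro ⟨a, b⟩
      simp only [extendHist, List.length_append, List.length_singleton, hl, if_true,
        histProb_append, nextExp, ← tsum_mul_left]
      exact tsum_congr fun y => by ring
    refine (tsum_congr key).trans ?_
    rw [tsum_eq_sum (s := G.actA x ×ˢ G.actB x), Finset.sum_product]
    · simp only [hl, if_true, condStep, Finset.mul_sum]
    · rintro ⟨a, b⟩ hab
      rw [Finset.mem_product, not_and_or] at hab
      rcases hab with ha | hb
      · simp [σ.supp h x a ha]
      · simp [τ.supp h x b hb]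
  · simp [extendHist, hl]

lemma histExp_mono (x₁ : G.X) (σ : Strategy1 G) (τ : Strategy2 G) (n : ℕ)
    {φ ψ : List (G.X × G.A × G.B) → G.X → ℝ}
    (hle : ∀ h x, h.length = n → φ h x ≤ ψ h x) :
    histExp x₁ σ τ n φ ≤ histExp x₁ σ τ n ψ := by
  refine (summable_histExp x₁ σ τ n φ).tsum_le_tsum (fun hx => ?_) (summable_histExp x₁ σ τ n ψ)
  split_ifs with hl
  · exact mul_le_mul_of_nonneg_left (hle _ _ hl) (histProb_nonneg _ _ _ _ _)
  · exact le_rfl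

lemma histExp_add (x₁ : G.X) (σ : Strategy1 G) (τ : Strategy2 G) (n : ℕ)
    (φ ψ : List (G.X × G.A × G.B) → G.X → ℝ) :
    histExp x₁ σ τ n (fun h x => φ h x + ψ h x) =
      histExp x₁ σ τ n φ + histExp x₁ σ τ n ψ := by
  rw [histExp, histExp, histExp,
    ← (summable_histExp x₁ σ τ n φ).tsum_add (summable_histExp x₁ σ τ n ψ)]
  refine tsum_congr fun hx => ?_
  split_ifs
  · ring
  · simp

lemma histExp_const_mul (x₁ : G.X) (σ : Strategy1 G) (τ : Strategy2 G) (n : ℕ) (c : ℝ)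
    (φ : List (G.X × G.A × G.B) → G.X → ℝ) :
    histExp x₁ σ τ n (fun h x => c * φ h x) = c * histExp x₁ σ τ n φ := by
  rw [histExp, histExp, ← tsum_mul_left]
  refine tsum_congr fun hx => ?_
  split_ifs
  · ring
  · simp

lemma sum_play_mul_play (σ : Strategy1 G) (τ : Strategy2 G) (h : List (G.X × G.A × G.B))
    (x : G.X) (c : ℝ) :
    ∑ a ∈ G.actA x, ∑ b ∈ G.actB x, σ.play h x a * τ.play h x b * c = c := by
  simp_rw [← Finset.sum_mul, ← Finset.mul_sum, τ.sum_one, mul_one, σ.sum_one, one_mul]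

lemma condStep_const (σ : Strategy1 G) (τ : Strategy2 G) (c : ℝ)
    (h : List (G.X × G.A × G.B)) (x : G.X) : condStep σ τ (fun _ _ => c) h x = c := by
  simp only [condStep, nextExp_const, sum_play_mul_play]

lemma histExp_const (x₁ : G.X) (σ : Strategy1 G) (τ : Strategy2 G) (n : ℕ) (c : ℝ) :
    histExp x₁ σ τ n (fun _ _ => c) = c := by
  induction n with
  | zero => rw [histExp_zero]
  | succ n ih =>
    rw [histExp_succ, ← ih]
    congr 1
    funext h x
    rw [condStep_const, ih]

lemma condStep_eq_sum_actB (σ : Strategy1 G) (τ : Strategy2 G) (f : G.X → ℝ)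
    (h : List (G.X × G.A × G.B)) (x : G.X) :
    condStep σ τ (fun _ => f) h x =
      ∑ b ∈ G.actB x, τ.play h x b * ∑ a ∈ G.actA x, σ.play h x a * G.nextExp f x a b := by
  rw [condStep, Finset.sum_comm]
  refine Finset.sum_congr rfl fun b _ => ?_
  rw [Finset.mul_sum]
  exact Finset.sum_congr rfl fun a _ => by ring

lemma isMixed1_play (σ : Strategy1 G) (h : List (G.X × G.A × G.B)) (x : G.X) :
    G.IsMixed1 x (σ.play h x) :=
  ⟨σ.nonneg h x, σ.supp h x, σ.sum_one h x⟩

/-- The Markov strategy of player 1 that plays optimally for the continuation payoff `f n`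
after `n` transitions. -/
def markovOpt (f : ℕ → G.X → ℝ) : Strategy1 G where
  play h x := G.optAct (f h.length) x
  nonneg _ x := (G.optAct_isMixed1 _ x).1
  supp _ x := (G.optAct_isMixed1 _ x).2.1
  sum_one _ x := (G.optAct_isMixed1 _ x).2.2

lemma markovOpt_stateDep (f : ℕ → G.X → ℝ) : (markovOpt (G := G) f).stateDep := by
  intro h h' x hh
  have : h.length = h'.length := by simpa using congrArg List.length hh
  simp [markovOpt, this]

lemma shapley_le_condStep_markovOpt (f : ℕ → G.X → ℝ) (τ : Strategy2 G)
    (h : List (G.X × G.A × G.B)) (x : G.X) :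
    G.shapley (f h.length) x ≤ condStep (markovOpt f) τ (fun _ => f h.length) h x := by
  rw [condStep_eq_sum_actB]
  calc G.shapley (f h.length) x = ∑ b ∈ G.actB x, τ.play h x b * G.shapley (f h.length) x := by
        rw [← Finset.sum_mul, τ.sum_one, one_mul]
    _ ≤ _ := Finset.sum_le_sum fun b hb =>
        mul_le_mul_of_nonneg_left (G.shapley_le_optAct _ x hb) (τ.nonneg _ _ _)

/-- The reply of player 2 to `σ` that minimizes the continuation payoff `f n` after `n`
transitions. -/
def bestReply (σ : Strategy1 G) (f : ℕ → G.X → ℝ) : Strategy2 G where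
  play h x b :=
    if b = (G.exists_le_shapley (f h.length) x (isMixed1_play σ h x)).choose then 1 else 0
  nonneg h x b := by split_ifs <;> norm_num
  supp h x b hb := by
    rw [if_neg]
    rintro rfl
    exact hb (G.exists_le_shapley (f h.length) x (isMixed1_play σ h x)).choose_spec.1
  sum_one h x := by
    rw [Finset.sum_ite_eq', if_pos]
    exact (G.exists_le_shapley (f h.length) x (isMixed1_play σ h x)).choose_spec.1

lemma condStep_bestReply_le (σ : Strategy1 G) (f : ℕ → G.X → ℝ)
    (h : List (G.X × G.A × G.B)) (x : G.X) :
    condStep σ (bestReply σ f) (fun _ => f h.length) h x ≤ G.shapley (f h.length) x := by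
  have hb := (G.exists_le_shapley (f h.length) x (isMixed1_play σ h x)).choose_spec
  rw [condStep_eq_sum_actB]
  simp only [bestReply, ite_mul, one_mul, zero_mul, Finset.sum_ite_eq', hb.1, if_true]
  exact hb.2

end StocGame

namespace RecGame

open StocGame

variable (G : RecGame)

lemma stateg_of_active {x : G.X} (hx : ¬ G.absorbing x) : G.stateg x = 0 :=
  G.g_active _ _ _ hx

lemma g_eq_stateg (x : G.X) (a : G.A) (b : G.B) : G.g x a b = G.stateg x := by
  by_cases hx : G.absorbing x
  · exact G.absorbing_g _ _ _ _ _ hx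
  · rw [stateg_of_active G hx, G.g_active _ _ _ hx]

lemma abs_stateg_le_one (x : G.X) : |G.stateg x| ≤ 1 := G.g_bdd _ _ _

lemma nextExp_of_absorbing {x : G.X} (hx : G.absorbing x) (f : G.X → ℝ) (a : G.A) (b : G.B) :
    G.toStocGame.nextExp f x a b = f x := by
  have hs : Summable (G.q x a b) := summable_of_hasFiniteSupport (G.q_finsupp x a b)
  have hq : ∀ y, y ≠ x → G.q x a b y = 0 := by
    intro y hy
    have h1 := hs.sum_le_tsum {x, y} fun z _ => G.q_nonneg x a b z
    rw [G.q_sum, Finset.sum_pair hy.symm, G.absorbing_q x a b hx] at h1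
    linarith [G.q_nonneg x a b y]
  rw [nextExp, tsum_eq_single x fun y hy => by rw [hq y hy, zero_mul], G.absorbing_q x a b hx,
    one_mul]

lemma shapley_of_absorbing {x : G.X} (hx : G.absorbing x) (f : G.X → ℝ) :
    G.toStocGame.shapley f x = f x := by
  have hp := G.toStocGame.optAct_isMixed1 f x
  have hsum : ∀ b, ∑ a ∈ G.actA x, G.toStocGame.optAct f x a * G.toStocGame.nextExp f x a b =
      f x := by
    intro b
    simp_rw [nextExp_of_absorbing G hx, ← Finset.sum_mul, hp.2.2, one_mul]
  obtain ⟨b, hb, hle⟩ := G.toStocGame.exists_le_shapley f x hp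
  have hge := G.toStocGame.shapley_le_optAct f x hb
  rw [hsum] at hle hge
  exact le_antisymm hge hle

lemma condStep_of_absorbing {x : G.X} (hx : G.absorbing x) (σ : G.toStocGame.Strategy1)
    (τ : G.toStocGame.Strategy2) (f : G.X → ℝ) (h : List (G.X × G.A × G.B)) :
    condStep σ τ (fun _ => f) h x = f x := by
  simp only [condStep, nextExp_of_absorbing G hx, sum_play_mul_play]

lemma stagePayoff_succ (x₁ : G.X) (σ : G.toStocGame.Strategy1) (τ : G.toStocGame.Strategy2)
    (n : ℕ) :
    G.toStocGame.stagePayoff x₁ σ τ (n + 1) = histExp x₁ σ τ n fun _ => G.stateg := by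
  rw [stagePayoff, histExp]
  refine tsum_congr fun hx => ?_
  simp only [Nat.add_right_cancel_iff, g_eq_stateg, sum_play_mul_play]

lemma absorbedProb_succ (x₁ : G.X) (σ : G.toStocGame.Strategy1) (τ : G.toStocGame.Strategy2)
    (n : ℕ) :
    G.absorbedProb x₁ σ τ (n + 1) =
      histExp x₁ σ τ n fun _ x => if G.absorbing x then 1 else 0 := by
  rw [absorbedProb, histExp]
  refine tsum_congr fun hx => ?_
  by_cases h1 : hx.1.length = n <;> by_cases h2 : G.absorbing hx.2 <;> simp [h1, h2]

lemma avgPayoff_eq (x₁ : G.X) (σ : G.toStocGame.Strategy1) (τ : G.toStocGame.Strategy2)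
    (n : ℕ) :
    G.toStocGame.avgPayoff x₁ σ τ n =
      (n : ℝ)⁻¹ * ∑ t ∈ Finset.range n, histExp x₁ σ τ t fun _ => G.stateg := by
  rw [avgPayoff, Finset.range_eq_Ico, ← Finset.Ico_add_one_right_eq_Icc,
    ← Finset.sum_Ico_add' _ 0 n 1]
  simp only [stagePayoff_succ]

lemma neg_one_le_histExp_stateg (x₁ : G.X) (σ : G.toStocGame.Strategy1)
    (τ : G.toStocGame.Strategy2) (n : ℕ) : -1 ≤ histExp x₁ σ τ n fun _ => G.stateg := by
  rw [← histExp_const x₁ σ τ n (-1)]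
  exact histExp_mono _ _ _ _ fun _ x _ => (abs_le.1 (G.abs_stateg_le_one x)).1

/-- The value of the total payoff over `n` stages, by backward induction. -/
def totalValue : ℕ → G.X → ℝ
  | 0, _ => 0
  | n + 1, x => G.stateg x + G.toStocGame.shapley (totalValue n) x

lemma sum_histExp_bestReply_le (x₁ : G.X) (σ : G.toStocGame.Strategy1) (n : ℕ) :
    ∑ t ∈ Finset.range n,
      histExp x₁ σ (bestReply σ fun k => G.totalValue (n - 1 - k)) t (fun _ => G.stateg) ≤
      G.totalValue n x₁ := by
  set τ := bestReply σ fun k => G.totalValue (n - 1 - k) with hτ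
  suffices h : ∀ k ≤ n, ∑ t ∈ Finset.range k, histExp x₁ σ τ t (fun _ => G.stateg) +
      histExp x₁ σ τ k (fun _ => G.totalValue (n - k)) ≤ G.totalValue n x₁ by
    have := h n le_rfl
    simpa [totalValue, histExp_const] using this
  intro k hk
  induction k with
  | zero => simp [histExp_zero]
  | succ k ih =>
    refine le_trans ?_ (ih (by omega))
    rw [Finset.sum_range_succ, histExp_succ, add_assoc, ← histExp_add]
    gcongr
    refine histExp_mono _ _ _ _ fun h x hl => ?_
    have h1 : n - k = n - (k + 1) + 1 := by omega
    have h2 : n - 1 - k = n - (k + 1) := by omega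
    have h3 := condStep_bestReply_le σ (fun k => G.totalValue (n - 1 - k)) h x
    rw [h1, totalValue]
    simp only [hl, h2] at h3
    gcongr

lemma nValue_le_totalValue {n : ℕ} (hn : 1 ≤ n) (x : G.X) :
    G.toStocGame.nValue n x ≤ G.totalValue n x / n := by
  have hn' : (0 : ℝ) < n := by exact_mod_cast hn
  have : Nonempty G.toStocGame.Strategy1 := ⟨markovOpt fun _ _ => 0⟩
  refine ciSup_le fun σ => ?_
  refine (ciInf_le ?_ (bestReply σ fun k => G.totalValue (n - 1 - k))).trans ?_
  · refine ⟨-1, ?_⟩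
    rintro _ ⟨τ, rfl⟩
    dsimp only
    rw [avgPayoff_eq, inv_mul_eq_div, le_div_iff₀ hn']
    calc (-1 : ℝ) * n = ∑ t ∈ Finset.range n, (-1 : ℝ) := by simp
      _ ≤ _ := Finset.sum_le_sum fun t _ => G.neg_one_le_histExp_stateg x σ τ t
  · rw [avgPayoff_eq, inv_mul_eq_div]
    gcongr
    exact G.sum_histExp_bestReply_le x σ n

/-- The terminal payoff equal to the absorbing payoff on absorbing states and to the
penalty `-L` on active states. -/
def penalized (L : ℝ) (x : G.X) : ℝ := if G.absorbing x then G.stateg x else -L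

/-- The value of the game with horizon `s` and terminal payoff `penalized L`. -/
def penalizedValue (L : ℝ) : ℕ → G.X → ℝ
  | 0 => G.penalized L
  | s + 1 => G.toStocGame.shapley (penalizedValue L s)

lemma neg_le_penalized {L : ℝ} (hL : 1 ≤ L) (x : G.X) : -L ≤ G.penalized L x := by
  rw [penalized]
  split_ifs
  · linarith [(abs_le.1 (G.abs_stateg_le_one x)).1]
  · exact le_rfl

lemma penalized_le_stateg {L : ℝ} (hL : 0 ≤ L) (x : G.X) : G.penalized L x ≤ G.stateg x := by
  rw [penalized]
  split_ifs with hx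
  · exact le_rfl
  · rw [stateg_of_active G hx]
    linarith

lemma neg_le_penalizedValue {L : ℝ} (hL : 1 ≤ L) (s : ℕ) (x : G.X) :
    -L ≤ G.penalizedValue L s x := by
  induction s generalizing x with
  | zero => exact G.neg_le_penalized hL x
  | succ s ih => exact G.toStocGame.le_shapley_of_le ih x

lemma penalizedValue_of_absorbing (L : ℝ) (s : ℕ) {x : G.X} (hx : G.absorbing x) :
    G.penalizedValue L s x = G.stateg x := by
  induction s with
  | zero => exact if_pos hx
  | succ s ih => rw [penalizedValue, shapley_of_absorbing G hx, ih]

/-- A lower bound on the penalized values at all long horizons improves by the mean value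
of any shorter block. -/
lemma totalValue_add_le {L m : ℝ} {S : ℕ}
    (h : ∀ s ≥ S, ∀ x, G.stateg x + m ≤ G.penalizedValue L s x) (k : ℕ) :
    ∀ s ≥ S + k, ∀ x, G.totalValue k x + k * m ≤ k * G.penalizedValue L s x := by
  induction k with
  | zero => simp [totalValue]
  | succ k ih =>
    intro s hs x
    obtain ⟨s, rfl⟩ : ∃ r, s = r + 1 := ⟨s - 1, by omega⟩
    have h1 := h (s + 1) (by omega) x
    have h2 := G.toStocGame.shapley_add_le (Nat.cast_nonneg k) (ih s (by omega)) x
    rw [← show G.penalizedValue L (s + 1) = G.toStocGame.shapley (G.penalizedValue L s)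
      from rfl] at h2
    rw [totalValue]
    push_cast
    linarith

lemma nValue_add_le_penalizedValue {L m : ℝ} {S n₀ n : ℕ}
    (h : ∀ s ≥ S, ∀ x, G.stateg x + m ≤ G.penalizedValue L s x) (hn : 1 ≤ n) (hn₀ : n ≤ n₀)
    {s : ℕ} (hs : S + n₀ ≤ s) (x : G.X) :
    G.toStocGame.nValue n x + m ≤ G.penalizedValue L s x := by
  have hn' : (0 : ℝ) < n := by exact_mod_cast hn
  have h1 := G.totalValue_add_le h n s (by omega) x
  have h2 := G.nValue_le_totalValue hn x
  rw [le_div_iff₀ hn'] at h2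
  refine le_of_mul_le_mul_left ?_ hn'
  linarith

lemma stateg_add_le_penalizedValue {M L : ℝ} (hM : 0 < M) (hL : 1 ≤ L) {n₀ : ℕ} {nmap : G.X → ℕ}
    (hnmap : ∀ x, ¬ G.absorbing x → 1 ≤ nmap x ∧ nmap x ≤ n₀)
    (hval : ∀ x, ¬ G.absorbing x → G.toStocGame.nValue (nmap x) x ≥ M) (j : ℕ) :
    ∀ s ≥ j * n₀, ∀ x, G.stateg x + min 0 (-L + j * M) ≤ G.penalizedValue L s x := by
  induction j with
  | zero =>
    intro s _ x
    have hmin : min 0 (-L + ((0 : ℕ) : ℝ) * M) ≤ -L := by simp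
    by_cases hx : G.absorbing x
    · rw [penalizedValue_of_absorbing G L s hx]
      linarith
    · rw [stateg_of_active G hx]
      linarith [G.neg_le_penalizedValue hL s x]
  | succ j ih =>
    intro s hs x
    by_cases hx : G.absorbing x
    · rw [penalizedValue_of_absorbing G L s hx]
      linarith [min_le_left 0 (-L + ((j + 1 : ℕ) : ℝ) * M)]
    · have h1 := G.nValue_add_le_penalizedValue ih (hnmap x hx).1 (hnmap x hx).2
        (s := s) (by linarith [Nat.succ_mul j n₀]) x
      have h2 := hval x hx
      rw [stateg_of_active G hx, zero_add]
      refine le_trans ?_ h1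
      push_cast
      rcases le_total 0 (-L + j * M) with h3 | h3
      · rw [min_eq_left h3]
        linarith [min_le_left 0 (-L + (j + 1 : ℝ) * M), hM]
      · rw [min_eq_right h3]
        linarith [min_le_right 0 (-L + (j + 1 : ℝ) * M)]

/-- The Markov strategy that is optimal for horizon `T` guarantees the penalized value at every
later stage. -/
lemma penalizedValue_le_histExp {L : ℝ} (hL : 1 ≤ L) (T : ℕ) (x₁ : G.X)
    (τ : G.toStocGame.Strategy2) {n : ℕ} (hn : T ≤ n) :
    G.penalizedValue L T x₁ ≤
      histExp x₁ (markovOpt fun k => G.penalizedValue L (T - 1 - k)) τ n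
        fun _ => G.penalized L := by
  set σ := markovOpt (G := G.toStocGame) fun k => G.penalizedValue L (T - 1 - k) with hσ
  have hT : ∀ k ≤ T, G.penalizedValue L T x₁ ≤
      histExp x₁ σ τ k fun _ => G.penalizedValue L (T - k) := by
    intro k hk
    induction k with
    | zero => simp [histExp_zero]
    | succ k ih =>
      refine (ih (by omega)).trans ?_
      rw [histExp_succ]
      refine histExp_mono _ _ _ _ fun h x hl => ?_
      have h1 : T - k = T - (k + 1) + 1 := by omega
      have h2 : T - 1 - k = T - (k + 1) := by omega
      have h3 := shapley_le_condStep_markovOpt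
        (fun k => G.penalizedValue L (T - 1 - k)) τ h x
      simp only [hl, h2] at h3
      rw [h1]
      exact h3
  induction n, hn using Nat.le_induction with
  | base => simpa [penalizedValue] using hT T le_rfl
  | succ n _ ih =>
    refine ih.trans ?_
    rw [histExp_succ]
    refine histExp_mono _ _ _ _ fun h x _ => ?_
    by_cases hx : G.absorbing x
    · rw [condStep_of_absorbing G hx]
    · rw [penalized, if_neg hx, ← condStep_const σ τ (-L) h x]
      refine Finset.sum_le_sum fun a _ => Finset.sum_le_sum fun b _ => ?_
      exact mul_le_mul_of_nonneg_left
        (G.toStocGame.nextExp_mono (G.neg_le_penalized hL) x a b)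
        (mul_nonneg (σ.nonneg _ _ _) (τ.nonneg _ _ _))

lemma histExp_penalized_le (L : ℝ) (x₁ : G.X) (σ : G.toStocGame.Strategy1)
    (τ : G.toStocGame.Strategy2) (n : ℕ) :
    histExp x₁ σ τ n (fun _ => G.penalized L) ≤
      (1 + L) * G.absorbedProb x₁ σ τ (n + 1) - L := by
  rw [absorbedProb_succ, ← histExp_const_mul, sub_eq_add_neg,
    ← histExp_const x₁ σ τ n (-L), ← histExp_add]
  refine histExp_mono _ _ _ _ fun h x _ => ?_
  rw [penalized]
  split_ifs
  · linarith [(abs_le.1 (G.abs_stateg_le_one x)).2]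
  · linarith

lemma absorbedProb_succ_le_one (x₁ : G.X) (σ : G.toStocGame.Strategy1)
    (τ : G.toStocGame.Strategy2) (n : ℕ) : G.absorbedProb x₁ σ τ (n + 1) ≤ 1 := by
  rw [absorbedProb_succ]
  refine (histExp_mono _ _ _ _ fun h x _ => ?_).trans_eq (histExp_const x₁ σ τ n 1)
  split_ifs <;> norm_num

end RecGame

/-- Let `Γ` be a positive-valued recursive game (countable state
space), with `M > 0`, `n₀ ≥ 1` and a map `n(·) : X⁰ → {1,…,n₀}` such that
`v_{n(x)}(x) ≥ M` for all active `x`. Then player 1 uniformly guarantees `v_{n(·)}(·)`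
with uniformly terminating strategies depending only on the states: for every `ε > 0`
there are `σ* ∈ Σ̂` and `N₀ ≥ 1` such that for every active initial state `x₁` and
every `τ`, (i) `P_{x₁,σ*,τ}(ρ ≤ N₀) ≥ 1 − ε` and (ii) `γ_n(x₁,σ*,τ) ≥ v_{n(x₁)}(x₁) − ε`
for all `n ≥ N₀`. -/
theorem positive_valued_recursive_game_guarantee
    (G : RecGame) (hcount : Countable G.X)
    (M : ℝ) (hM : 0 < M) (n₀ : ℕ) (hn₀ : 1 ≤ n₀) (nmap : G.X → ℕ)
    (hnmap : ∀ x, ¬ G.absorbing x → 1 ≤ nmap x ∧ nmap x ≤ n₀)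
    (hval : ∀ x, ¬ G.absorbing x → G.toStocGame.nValue (nmap x) x ≥ M) :
    ∀ ε > (0 : ℝ), ∃ σstar : G.toStocGame.Strategy1, σstar.stateDep ∧
      ∃ N₀ : ℕ, 1 ≤ N₀ ∧
      ∀ x₁, ¬ G.absorbing x₁ → ∀ τ : G.toStocGame.Strategy2,
        G.absorbedProb x₁ σstar τ N₀ ≥ 1 - ε ∧
        ∀ n ≥ N₀, G.toStocGame.avgPayoff x₁ σstar τ n ≥
          G.toStocGame.nValue (nmap x₁) x₁ - ε := by
  intro ε hε
  set L : ℝ := max 1 ε⁻¹ with hLdef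
  have hL : 1 ≤ L := le_max_left _ _
  have hLε : 1 ≤ L * ε := by
    calc (1 : ℝ) = ε⁻¹ * ε := (inv_mul_cancel₀ hε.ne').symm
      _ ≤ L * ε := by gcongr; exact le_max_right _ _
  obtain ⟨j, hj⟩ := exists_nat_ge (L / M)
  rw [div_le_iff₀ hM] at hj
  set T : ℕ := j * n₀ + n₀ with hT
  obtain ⟨K, hK⟩ := exists_nat_ge (2 * T / ε)
  rw [div_le_iff₀ hε] at hK
  refine ⟨StocGame.markovOpt fun k => G.penalizedValue L (T - 1 - k),
    StocGame.markovOpt_stateDep _, T + K + 1, by omega, fun x₁ hx₁ τ => ?_⟩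
  set σ := StocGame.markovOpt (G := G.toStocGame) fun k => G.penalizedValue L (T - 1 - k)
  have hlow : G.toStocGame.nValue (nmap x₁) x₁ ≤ G.penalizedValue L T x₁ := by
    have := G.nValue_add_le_penalizedValue (G.stateg_add_le_penalizedValue hM hL hnmap hval j)
      (hnmap x₁ hx₁).1 (hnmap x₁ hx₁).2 (s := T) le_rfl x₁
    rwa [min_eq_left (by linarith), add_zero] at this
  have hlate : ∀ n ≥ T, G.toStocGame.nValue (nmap x₁) x₁ ≤
      StocGame.histExp x₁ σ τ n fun _ => G.penalized L :=
    fun n hn => hlow.trans (G.penalizedValue_le_histExp hL T x₁ τ hn)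
  have hV := hval x₁ hx₁
  have hle1 : ∀ n, StocGame.histExp x₁ σ τ n (fun _ => G.penalized L) ≤ 1 := fun n => by
    nlinarith [G.histExp_penalized_le L x₁ σ τ n, G.absorbedProb_succ_le_one x₁ σ τ n]
  refine ⟨?_, fun n hn => ?_⟩
  · have h1 := hlate (T + K) (by omega)
    have h2 := G.histExp_penalized_le L x₁ σ τ (T + K)
    have h3 := G.absorbedProb_succ_le_one x₁ σ τ (T + K)
    nlinarith
  · set v := G.toStocGame.nValue (nmap x₁) x₁
    have hv1 : v ≤ 1 := (hlate T le_rfl).trans (hle1 T)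
    have hn' : (0 : ℝ) < n := by exact_mod_cast (by omega : 0 < n)
    have hKn : (K : ℝ) ≤ n := by exact_mod_cast (by omega : K ≤ n)
    obtain ⟨r, rfl⟩ : ∃ r, n = T + r := ⟨n - T, by omega⟩
    rw [ge_iff_le, RecGame.avgPayoff_eq, inv_mul_eq_div, le_div_iff₀ hn',
      Finset.sum_range_add]
    have h1 : -(T : ℝ) ≤
        ∑ t ∈ Finset.range T, StocGame.histExp x₁ σ τ t fun _ => G.stateg := by
      calc -(T : ℝ) = ∑ t ∈ Finset.range T, (-1 : ℝ) := by simp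
        _ ≤ _ := Finset.sum_le_sum fun t _ => G.neg_one_le_histExp_stateg x₁ σ τ t
    have h2 : r * v ≤
        ∑ t ∈ Finset.range r, StocGame.histExp x₁ σ τ (T + t) fun _ => G.stateg := by
      calc r * v = ∑ t ∈ Finset.range r, v := by simp
        _ ≤ _ := Finset.sum_le_sum fun t _ => (hlate (T + t) (by omega)).trans
          (StocGame.histExp_mono _ _ _ _ fun _ x _ => G.penalized_le_stateg (by linarith) x)
    have h3 : (K : ℝ) * ε ≤ ((T + r : ℕ) : ℝ) * ε := by gcongr
    have h4 : (T : ℝ) * v ≤ T := mul_le_of_le_one_right (Nat.cast_nonneg T) hv1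
    push_cast at h3 ⊢
    linarith
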